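/- arXiv:2302.10263 — 2 statements merged into one kernel-verified Lean document; each statement's English description precedes it below -/
import Mathlib

section
/- Let S be a semigroup and σ : S → S an automorphism. Suppose f, g : S → ℂ satisfy the variant equation f(σ(y)·x) = f(x)g(y) + f(y)g(x) for all x, y ∈ S, and suppose f and g are linearly independent. Then f ∘ σ = f and g ∘ σ = g. -/
open Complex

/-- Coefficients with respect to two linearly independent functions are unique. -/
theorem coeff_unique {S : Type*} {f g : S → ℂ}
    (hindep : ∀ a b : ℂ, (∀ x : S, a * f x + b * g x = 0) → a = 0 ∧ b = 0)
    {a b c d : ℂ} (h : ∀ x, a * f x + b * g x = c * f x + d * g x) : a = c ∧ b = d := by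
  obtain ⟨h₁, h₂⟩ := hindep (a - c) (b - d) fun x => by linear_combination h x
  exact ⟨sub_eq_zero.mp h₁, sub_eq_zero.mp h₂⟩

/-- Addition formulas for `f`, `g` and for the `σ`-twisted translates of `g`. -/
theorem exists_addition_formulas {S : Type*} [Semigroup S] {σ : S → S}
    (hσmul : ∀ x y : S, σ (x * y) = σ x * σ y) {f g : S → ℂ}
    (heq : ∀ x y : S, f (σ y * x) = f x * g y + f y * g x)
    (hindep : ∀ a b : ℂ, (∀ x : S, a * f x + b * g x = 0) → a = 0 ∧ b = 0)
    {y₀ : S} (hy₀ : f y₀ ≠ 0) :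
    ∃ A B : S → ℂ, (∀ x z, g (σ z * x) = f x * A z + g x * B z) ∧
      (∀ y z, f (y * z) = f y * B z + g y * f z) ∧
      (∀ y z, g (y * z) = f y * A z + g y * g z) := by
  have assoc_eq : ∀ x y z, f y * g (σ z * x) =
      (g (y * z) - g y * g z) * f x + (f (y * z) - f z * g y) * g x := by
    intro x y z
    have h₁ := heq x (y * z)
    rw [hσmul, mul_assoc, heq (σ z * x) y, heq x z] at h₁
    linear_combination h₁
  refine ⟨fun z => (g (y₀ * z) - g y₀ * g z) / f y₀,
    fun z => (f (y₀ * z) - f z * g y₀) / f y₀, ?_⟩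
  have hg : ∀ x z, g (σ z * x) = f x * ((g (y₀ * z) - g y₀ * g z) / f y₀) +
      g x * ((f (y₀ * z) - f z * g y₀) / f y₀) := by
    intro x z
    field_simp
    linear_combination assoc_eq x y₀ z
  have hcoeff := fun y z => coeff_unique hindep
    (a := f y * ((g (y₀ * z) - g y₀ * g z) / f y₀))
    (b := f y * ((f (y₀ * z) - f z * g y₀) / f y₀))
    (c := g (y * z) - g y * g z) (d := f (y * z) - f z * g y)
    fun x => by linear_combination assoc_eq x y z - f y * hg x z
  exact ⟨hg, fun y z => by linear_combination -(hcoeff y z).2,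
    fun y z => by linear_combination -(hcoeff y z).1⟩

theorem stmt_7 {S : Type*} [Semigroup S] (σ : S → S)
    (hσbij : Function.Bijective σ)
    (hσmul : ∀ x y : S, σ (x * y) = σ x * σ y)
    (f g : S → ℂ)
    (heq : ∀ x y : S, f (σ y * x) = f x * g y + f y * g x)
    (hindep : ∀ a b : ℂ, (∀ x : S, a * f x + b * g x = 0) → a = 0 ∧ b = 0) :
    (∀ x : S, f (σ x) = f x) ∧ (∀ x : S, g (σ x) = g x) := by
  obtain ⟨y₀, hy₀⟩ : ∃ y, f y ≠ 0 := by
    by_contra! h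
    exact one_ne_zero (hindep 1 0 fun x => by simp [h x]).1
  obtain ⟨t, ht⟩ := hσbij.surjective y₀
  have hft : f (σ t) ≠ 0 := ht ▸ hy₀
  obtain ⟨A, B, hgσ, hf, hg⟩ := exists_addition_formulas hσmul heq hindep hy₀
  have hσB : ∀ x y, f (σ y) * B x = (g y - g (σ y)) * f x + f y * g x := fun x y => by
    linear_combination heq x y - hf (σ y) x
  obtain ⟨a, b, hB⟩ : ∃ a b : ℂ, ∀ x, B x = a * f x + b * g x :=
    ⟨(g t - g (σ t)) / f (σ t), f t / f (σ t), fun x => by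
      field_simp
      linear_combination hσB x t⟩
  have hσ := fun y => coeff_unique hindep (a := f (σ y) * a) (b := f (σ y) * b)
    (c := g y - g (σ y)) (d := f y) fun x => by
      linear_combination hσB x y - f (σ y) * hB x
  have hb : b ≠ 0 := by
    rintro rfl
    exact hy₀ (by rw [← (hσ y₀).2, mul_zero])
  have hA : ∀ x z, f z * A x =
      b * A z * f x + ((a + a * b) * f z + (b ^ 2 - b) * g z) * g x := by
    intro x z
    linear_combination b * hgσ x z - b * hg (σ z) x + b * g x * hB z
      - b * g x * (hσ z).1 + (-A x + a * g x) * (hσ z).2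
  obtain ⟨p, q, hpq⟩ : ∃ p q : ℂ, ∀ x, A x = p * f x + q * g x :=
    ⟨b * A y₀ / f y₀, ((a + a * b) * f y₀ + (b ^ 2 - b) * g y₀) / f y₀, fun x => by
      field_simp
      linear_combination hA x y₀⟩
  have hcoeff := fun z => coeff_unique hindep (a := f z * p) (b := f z * q)
    (c := b * A z) (d := (a + a * b) * f z + (b ^ 2 - b) * g z) fun x => by
      linear_combination hA x z - f z * hpq x
  have hbq := (coeff_unique hindep (a := p) (b := 0) (c := b * p) (d := b * q) fun z => by
    linear_combination (hcoeff z).1 + b * hpq z).2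
  have hqa := coeff_unique hindep (a := q) (b := 0) (c := a + a * b) (d := b ^ 2 - b) fun z => by
    linear_combination (hcoeff z).2
  have hb1 : b = 1 := mul_left_cancel₀ hb (by linear_combination -hqa.2)
  subst hb1
  have ha : a = 0 := by linear_combination (-hbq - hqa.1) / 2
  subst ha
  exact ⟨fun x => by linear_combination (hσ x).2, fun x => by linear_combination (hσ x).1⟩
end

section
/- Let S be a semigroup and σ : S → S an automorphism. Functions f, g : S → ℂ satisfy f(x·σ(y)) = f(x)g(y) + f(y)g(x) for all x, y ∈ S if and only if one of the following holds: (1) f = 0 and g is arbitrary; (2) f is a nonzero function with f(xy) = 0 for all x, y ∈ S, and g = 0; (3) there exist α ∈ ℂ \ {0} and a nonzero multiplicative function χ : S → ℂ with χ ∘ σ = χ such that f = χ/(2α) and g = χ/2; (4) there exist c ∈ ℂ \ {0} and two distinct multiplicative functions χ₁, χ₂ : S → ℂ with χ₁ ∘ σ = χ₁ and χ₂ ∘ σ = χ₂ such that f = c·(χ₁ − χ₂) and g = (χ₁ + χ₂)/2; or (5) there exist a nonzero multiplicative function χ : S → ℂ with χ ∘ σ = χ and a function φ : S → ℂ satisfying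 φ(xy) = φ(x)χ(y) + φ(y)χ(x) for all x, y ∈ S and φ ∘ σ = φ, such that f = φ and g = χ. -/
open Complex

/-- A nonzero function that is multiplicative up to a surjective twist `σ` in the second variable is
`σ`-invariant and multiplicative. -/
theorem multiplicative_of_twisted {S : Type*} [Semigroup S] {σ : S → S}
    (hσ : Function.Surjective σ) (hσmul : ∀ x y : S, σ (x * y) = σ x * σ y)
    {χ : S → ℂ} (hχ : χ ≠ 0) (h : ∀ x y : S, χ (x * σ y) = χ x * χ y) :
    (∀ x y : S, χ (x * y) = χ x * χ y) ∧ ∀ x : S, χ (σ x) = χ x := by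
  obtain ⟨w, hw⟩ := Function.ne_iff.mp hχ
  have hw : χ w ≠ 0 := hw
  have hinv : ∀ z, χ (σ z) = χ z := by
    intro z
    have h1 := h w (w * σ z)
    rw [hσmul, ← mul_assoc, h, h, h] at h1
    have h2 : χ w * χ w * (χ (σ z) - χ z) = 0 := by linear_combination h1
    simpa [hw, sub_eq_zero] using h2
  refine ⟨fun x y => ?_, hinv⟩
  obtain ⟨y, rfl⟩ := hσ y
  rw [h, hinv]

/-- If `(f, g)` solves the twisted sine addition law with `f, g` linearly independent, then both
functions are `σ`-invariant and `g` satisfies a cosine addition law. -/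
theorem cosine_law_of_twisted_sine_law {S : Type*} [Semigroup S] {σ : S → S}
    (hσ : Function.Surjective σ) (hσmul : ∀ x y : S, σ (x * y) = σ x * σ y) {f g : S → ℂ}
    (hI : ∀ a b : ℂ, (∀ x, a * f x + b * g x = 0) → a = 0 ∧ b = 0)
    (h : ∀ x y : S, f (x * σ y) = f x * g y + f y * g x) :
    (∀ x, f (σ x) = f x) ∧ (∀ x, g (σ x) = g x) ∧
      ∃ s : ℂ, ∀ x y, g (x * y) = g x * g y + s * (f x * f y) := by
  have hf : ∃ w, f w ≠ 0 := by
    by_contra! hc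
    simpa using (hI 1 0 fun x => by simp [hc]).1
  obtain ⟨w, hw⟩ := hf
  have assoc : ∀ x y z, f x * g (y * σ z) + g x * (f y * g z + f z * g y) =
      (f x * g y + f y * g x) * g (σ z) + f (σ z) * g (x * σ y) := by
    intro x y z
    have h1 := h x (y * σ z)
    rw [hσmul, ← mul_assoc, h, h, h] at h1
    linear_combination -h1
  obtain ⟨a, p, q, hg⟩ : ∃ (a : S → ℂ) (p q : ℂ),
      ∀ x y, g (x * σ y) = f x * a y + g x * (p * f y + q * g y) := by
    obtain ⟨z, rfl⟩ := hσ w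
    refine ⟨fun y => (g (y * σ z) - g y * g (σ z)) / f (σ z), (g z - g (σ z)) / f (σ z),
      f z / f (σ z), fun x y => ?_⟩
    field_simp
    linear_combination -assoc x y z
  have coeff : ∀ y z, g (y * σ z) - g y * g (σ z) - f (σ z) * a y = 0 ∧
      f y * g z + f z * g y - f y * g (σ z) - f (σ z) * (p * f y + q * g y) = 0 := by
    refine fun y z => hI _ _ fun x => ?_
    linear_combination assoc x y z + f (σ z) * hg x y
  have shift : ∀ z, g z - g (σ z) - p * f (σ z) = 0 ∧ f z - q * f (σ z) = 0 :=
    fun z => hI _ _ fun y => by linear_combination (coeff y z).2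
  have hq : q ≠ 0 := by
    rintro rfl
    exact hw (by linear_combination (shift w).2)
  have hp : p = 0 := by
    have h1 := h (σ w) (σ w)
    rw [← hσmul] at h1
    have h2 := (shift (w * σ w)).2
    rw [h, h1] at h2
    have h3 : p * (f (σ w) * f w) = 0 := by
      linear_combination h2 / 2 - f w * (shift w).1 - g (σ w) * (shift w).2
    have h4 : f (σ w) ≠ 0 := by
      intro h0
      exact hw (by linear_combination (shift w).2 + q * h0)
    simpa [h4, hw] using h3
  subst hp
  have hgσ : ∀ z, g (σ z) = g z := fun z => by linear_combination -(shift z).1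
  have hfσ : ∀ z, f (σ z) = f z / q := fun z => by
    rw [eq_div_iff hq]
    linear_combination -(shift z).2
  have compare : ∀ y z, f y * a z + (q - 1) * (g y * g z) - f z / q * a y = 0 := fun y z => by
    rw [← hfσ]
    linear_combination (coeff y z).1 - hg y z + g y * hgσ z
  obtain ⟨s, t, ha⟩ : ∃ s t : ℂ, ∀ z, a z = s * f z + t * g z := by
    refine ⟨a w / (q * f w), -(q - 1) * g w / f w, fun z => ?_⟩
    have h1 := compare w z
    field_simp at h1 ⊢
    linear_combination h1
  have split : ∀ z, s * f z + t * g z - f z / q * s = 0 ∧ (q - 1) * g z - f z / q * t = 0 := by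
    refine fun z => hI _ _ fun y => ?_
    have h1 := compare y z
    rw [ha, ha] at h1
    linear_combination h1
  have ht : t = 0 := (hI (s - s / q) t fun z => by linear_combination (split z).1).2
  have hq1 : q - 1 = 0 := (hI (-t / q) (q - 1) fun z => by linear_combination (split z).2).2
  obtain rfl : q = 1 := by linear_combination hq1
  subst ht
  refine ⟨fun x => by simpa using hfσ x, hgσ, s, fun x y => ?_⟩
  obtain ⟨y, rfl⟩ := hσ y
  rw [hg, ha, hgσ, hfσ]
  ring

theorem stmt_8 {S : Type*} [Semigroup S] (σ : S → S)
    (hσbij : Function.Bijective σ)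
    (hσmul : ∀ x y : S, σ (x * y) = σ x * σ y)
    (f g : S → ℂ) :
    (∀ x y : S, f (x * σ y) = f x * g y + f y * g x) ↔
    ((f = 0) ∨
     (f ≠ 0 ∧ (∀ x y : S, f (x * y) = 0) ∧ g = 0) ∨
     (∃ (α : ℂ) (χ : S → ℂ), α ≠ 0 ∧ χ ≠ 0 ∧
       (∀ x y : S, χ (x * y) = χ x * χ y) ∧ (∀ x : S, χ (σ x) = χ x) ∧
       f = (fun x => χ x / (2 * α)) ∧ g = (fun x => χ x / 2)) ∨
     (∃ (c : ℂ) (χ₁ χ₂ : S → ℂ), c ≠ 0 ∧ χ₁ ≠ χ₂ ∧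
       (∀ x y : S, χ₁ (x * y) = χ₁ x * χ₁ y) ∧
       (∀ x y : S, χ₂ (x * y) = χ₂ x * χ₂ y) ∧
       (∀ x : S, χ₁ (σ x) = χ₁ x) ∧ (∀ x : S, χ₂ (σ x) = χ₂ x) ∧
       f = (fun x => c * (χ₁ x - χ₂ x)) ∧ g = (fun x => (χ₁ x + χ₂ x) / 2)) ∨
     (∃ (χ φ : S → ℂ), χ ≠ 0 ∧
       (∀ x y : S, χ (x * y) = χ x * χ y) ∧ (∀ x : S, χ (σ x) = χ x) ∧
       (∀ x y : S, φ (x * y) = φ x * χ y + φ y * χ x) ∧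
       (∀ x : S, φ (σ x) = φ x) ∧
       f = φ ∧ g = χ)) := by
  have hσ := hσbij.surjective
  constructor
  · intro h
    by_cases hf : f = 0
    · exact Or.inl hf
    by_cases hdep : ∃ β : ℂ, ∀ x, g x = β * f x
    · obtain ⟨β, hβ⟩ := hdep
      by_cases hβ0 : β = 0
      · subst hβ0
        have hg : ∀ x, g x = 0 := fun x => by simp [hβ]
        refine Or.inr (Or.inl ⟨hf, fun x y => ?_, funext hg⟩)
        obtain ⟨y, rfl⟩ := hσ y
        simp [h, hg]
      · have hχ : (fun x => 2 * β * f x) ≠ 0 := by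
          intro h0
          refine hf (funext fun x => ?_)
          simpa [hβ0] using congrFun h0 x
        obtain ⟨hm, hinv⟩ := multiplicative_of_twisted hσ hσmul hχ fun x y => by
          simp only [h, hβ]
          ring
        refine Or.inr (Or.inr (Or.inl ⟨β, _, hβ0, hχ, hm, hinv, ?_, ?_⟩))
        · funext x
          field_simp
        · funext x
          rw [hβ]
          ring
    · have hI : ∀ a b : ℂ, (∀ x, a * f x + b * g x = 0) → a = 0 ∧ b = 0 := by
        intro a b hab
        have hb : b = 0 := by
          by_contra hb
          refine hdep ⟨-a / b, fun x => ?_⟩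
          field_simp
          linear_combination hab x
        obtain ⟨w, hw⟩ := Function.ne_iff.mp hf
        have hw : f w ≠ 0 := hw
        subst hb
        exact ⟨by simpa [hw] using hab w, rfl⟩
      obtain ⟨hfσ, hgσ, s, hg⟩ := cosine_law_of_twisted_sine_law hσ hσmul hI h
      have hfm : ∀ x y, f (x * y) = f x * g y + f y * g x := by
        intro x y
        obtain ⟨y, rfl⟩ := hσ y
        rw [h, hfσ, hgσ]
      obtain ⟨δ, rfl⟩ : ∃ δ : ℂ, s = δ ^ 2 :=
        (IsAlgClosed.exists_pow_nat_eq s two_pos).imp fun _ => Eq.symm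
      by_cases hδ : δ = 0
      · subst hδ
        refine Or.inr (Or.inr (Or.inr (Or.inr
          ⟨g, f, ?_, fun x y => by simp [hg], hgσ, hfm, hfσ, rfl, rfl⟩)))
        rintro rfl
        exact hdep ⟨0, fun x => by simp⟩
      · refine Or.inr (Or.inr (Or.inr (Or.inl
          ⟨1 / (2 * δ), fun x => g x + δ * f x, fun x => g x - δ * f x, by simp [hδ], ?_,
            fun x y => ?_, fun x y => ?_, fun x => ?_, fun x => ?_, ?_, ?_⟩)))
        · intro heq
          refine hf (funext fun x => ?_)
          have h1 : g x + δ * f x = g x - δ * f x := congrFun heq x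
          have h2 : δ * f x = 0 := by linear_combination h1 / 2
          simpa [hδ] using h2
        · simp only [hg, hfm]
          ring
        · simp only [hg, hfm]
          ring
        · simp only [hfσ, hgσ]
        · simp only [hfσ, hgσ]
        · funext x
          field_simp
          ring
        · funext x
          ring
  · rintro (rfl | ⟨-, hf, rfl⟩ | ⟨α, χ, hα, -, hm, hinv, rfl, rfl⟩ |
      ⟨c, χ₁, χ₂, -, -, hm₁, hm₂, hinv₁, hinv₂, rfl, rfl⟩ |
      ⟨χ, φ, -, -, hinv, hφ, hφσ, rfl, rfl⟩) x y
    · simp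
    · simp [hf]
    · simp only [hm, hinv]
      field_simp
      ring
    · simp only [hm₁, hm₂, hinv₁, hinv₂]
      ring
    · rw [hφ, hinv, hφσ]
end
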